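/- Let λ = (ℓ+m, ℓ) with ℓ ≥ 2 and m ≥ 0, let w₀ be the canonical generator of the parabolic Verma module N(λ), and set w_i = U^i·w₀ for 0 ≤ i ≤ ⌊m/2⌋ (with the parameter of U updated to match the weight of its argument at each step). Say a weight (x,y) has parity 0 if x ≡ ℓ+m (mod 2) and parity 1 otherwise, and let N(λ)_{par(i)} denote the linear span of all vectors v ∈ N(λ) that have a weight of parity i and satisfy N₊·v = 0. Then: (1) the vectors X₊^α·D₊^β·w_i (α, β ≥ 0, 0 ≤ i ≤ ⌊m/2⌋) are linearly independent and span N(λ)_{par(0)}; (2) if m is odd, the operator E₊ maps N(λ)_{par(0)} bijectively onto N(λ)_{par(1)}; (3) if m is even, E₊ maps N(λ)_{par(0)} onto N(λ)_{par(1)}, and its kernel is spanned by the vectors X₊^α·D₊^β·w_{m/2} (α, β ≥ 0). -/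

import Mathlib

/- Prelude: lowest weight modules for sp(4,C) -/

set_option linter.unusedVariables false

noncomputable section

open Complex

abbrev M4C := Matrix (Fin 4) (Fin 4) ℂ

def J4 : M4C := !![0,0,1,0; 0,0,0,1; -1,0,0,0; 0,-1,0,0]

/-- The Lie algebra `sp₄(ℂ)` of matrices `g` with `ᵀg J + J g = 0`. -/
def sp4 : Set M4C := {g | g.transpose * J4 + J4 * g = 0}

def ZM : M4C := (-I) • !![0,0,1,0; 0,0,0,0; -1,0,0,0; 0,0,0,0]
def ZM' : M4C := (-I) • !![0,0,0,0; 0,0,0,1; 0,0,0,0; 0,-1,0,0]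
def NPlus : M4C := ((1:ℂ)/2) • !![0,1,0,-I; -1,0,-I,0; 0,I,0,1; I,0,-1,0]
def NMinus : M4C := ((1:ℂ)/2) • !![0,1,0,I; -1,0,I,0; 0,-I,0,1; -I,0,-1,0]
def XPlus : M4C := ((1:ℂ)/2) • !![1,0,I,0; 0,0,0,0; I,0,-1,0; 0,0,0,0]
def XMinus : M4C := ((1:ℂ)/2) • !![1,0,-I,0; 0,0,0,0; -I,0,-1,0; 0,0,0,0]
def P1Plus : M4C := ((1:ℂ)/2) • !![0,1,0,I; 1,0,I,0; 0,I,0,-1; I,0,-1,0]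
def P1Minus : M4C := ((1:ℂ)/2) • !![0,1,0,-I; 1,0,-I,0; 0,-I,0,-1; -I,0,-1,0]
def P0Plus : M4C := ((1:ℂ)/2) • !![0,0,0,0; 0,1,0,I; 0,0,0,0; 0,I,0,-1]
def P0Minus : M4C := ((1:ℂ)/2) • !![0,0,0,0; 0,1,0,-I; 0,0,0,0; 0,-I,0,-1]

/-- The standard basis of `sp₄(ℂ)`. -/
def sp4Gens : Set M4C :=
  {ZM, ZM', NPlus, NMinus, XPlus, XMinus, P1Plus, P1Minus, P0Plus, P0Minus}

variable {V : Type} [AddCommGroup V] [Module ℂ V]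

/-- `ρ` is a representation of `sp₄(ℂ)` on `V`: a linear assignment of endomorphisms
turning brackets of elements of `sp₄` into commutators. -/
def IsRep (ρ : M4C →ₗ[ℂ] Module.End ℂ V) : Prop :=
  ∀ A ∈ sp4, ∀ B ∈ sp4, ρ (A * B - B * A) = ρ A * ρ B - ρ B * ρ A

/-- `w` generates `V` as a `U(𝔤)`-module. -/
def Generates (ρ : M4C →ₗ[ℂ] Module.End ℂ V) (w : V) : Prop :=
  ∀ v : V, v ∈ Submodule.span ℂ
    {x : V | ∃ ops : List M4C, (∀ A ∈ ops, A ∈ sp4Gens) ∧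
      x = (ops.map (fun A => ρ A)).prod w}

/-- The PBW-type vector `X₊^α P₁₊^β P₀₊^γ N₋^δ · w` for `t = (α, β, γ, δ)`. -/
def pbwVec (ρ : M4C →ₗ[ℂ] Module.End ℂ V) (w : V) (t : ℕ × ℕ × ℕ × ℕ) : V :=
  ((ρ XPlus) ^ t.1 * (ρ P1Plus) ^ t.2.1 * (ρ P0Plus) ^ t.2.2.1 * (ρ NMinus) ^ t.2.2.2) w

/-- `(V, ρ, w)` is a realization of the parabolic Verma module `N(k, ℓ)` with canonical
generator `w`: `w` is a vector of weight `(k, ℓ)` annihilated by `N₊` and by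
`𝔭₋ = ⟨X₋, P₁₋, P₀₋⟩`, with `N₋^{k-ℓ+1} w = 0`, generating `V`, and the PBW vectors
`X₊^α P₁₊^β P₀₊^γ N₋^δ w` (`α,β,γ ≥ 0`, `0 ≤ δ ≤ k-ℓ`) form a `ℂ`-basis of `V`. -/
structure IsVerma (k l : ℤ) (ρ : M4C →ₗ[ℂ] Module.End ℂ V) (w : V) : Prop where
  rep : IsRep ρ
  le : l ≤ k
  ne : w ≠ 0
  wtZ : ρ ZM w = (k : ℂ) • w
  wtZ' : ρ ZM' w = (l : ℂ) • w
  annNPlus : ρ NPlus w = 0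
  annXMinus : ρ XMinus w = 0
  annP1Minus : ρ P1Minus w = 0
  annP0Minus : ρ P0Minus w = 0
  annNMinusPow : ((ρ NMinus) ^ ((k - l).toNat + 1)) w = 0
  gen : Generates ρ w
  indep : LinearIndependent ℂ
    (fun t : {t : ℕ × ℕ × ℕ × ℕ // (t.2.2.2 : ℤ) ≤ k - l} => pbwVec ρ w t.1)
  spans : ∀ v : V, v ∈ Submodule.span ℂ
    (Set.range (fun t : {t : ℕ × ℕ × ℕ × ℕ // (t.2.2.2 : ℤ) ≤ k - l} => pbwVec ρ w t.1))

/-- A `ℂ`-subspace invariant under the action of `sp₄(ℂ)`. -/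
def IsInvariantSub (ρ : M4C →ₗ[ℂ] Module.End ℂ V) (W : Submodule ℂ V) : Prop :=
  ∀ A ∈ sp4, ∀ v ∈ W, ρ A v ∈ W

/-- Irreducibility of a representation of `sp₄(ℂ)`. -/
def IsIrreducibleRep (ρ : M4C →ₗ[ℂ] Module.End ℂ V) : Prop :=
  (∃ v : V, v ≠ 0) ∧ ∀ W : Submodule ℂ V, IsInvariantSub ρ W → W = ⊥ ∨ W = ⊤

/-- `(V, ρ, w)` is a realization of the irreducible lowest weight module `L(k, ℓ)` (the
unique irreducible quotient of `N(k, ℓ)`), with lowest weight vector `w`. -/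
structure IsHWIrred (k l : ℤ) (ρ : M4C →ₗ[ℂ] Module.End ℂ V) (w : V) : Prop where
  rep : IsRep ρ
  le : l ≤ k
  ne : w ≠ 0
  wtZ : ρ ZM w = (k : ℂ) • w
  wtZ' : ρ ZM' w = (l : ℂ) • w
  annNPlus : ρ NPlus w = 0
  annXMinus : ρ XMinus w = 0
  annP1Minus : ρ P1Minus w = 0
  annP0Minus : ρ P0Minus w = 0
  annNMinusPow : ((ρ NMinus) ^ ((k - l).toNat + 1)) w = 0
  gen : Generates ρ w
  irred : IsIrreducibleRep ρ

/-- The operator `U = m(m-1) P₀₊ + (m-1) P₁₊ N₋ + X₊ N₋²` (with parameter `m`). -/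
def opU (ρ : M4C →ₗ[ℂ] Module.End ℂ V) (m : ℤ) : Module.End ℂ V :=
  ((m * (m - 1) : ℤ) : ℂ) • ρ P0Plus + ((m - 1 : ℤ) : ℂ) • (ρ P1Plus * ρ NMinus)
    + ρ XPlus * (ρ NMinus) ^ 2

/-- The operator `L = m(m-1) X₋ - (m-1) P₁₋ N₋ + P₀₋ N₋²` (with parameter `m`). -/
def opL (ρ : M4C →ₗ[ℂ] Module.End ℂ V) (m : ℤ) : Module.End ℂ V :=
  ((m * (m - 1) : ℤ) : ℂ) • ρ XMinus - ((m - 1 : ℤ) : ℂ) • (ρ P1Minus * ρ NMinus)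
    + ρ P0Minus * (ρ NMinus) ^ 2

/-- The operator `E₊ = (m+2) P₁₊ + 2 N₋ X₊` (with parameter `m`). -/
def opEp (ρ : M4C →ₗ[ℂ] Module.End ℂ V) (m : ℤ) : Module.End ℂ V :=
  ((m + 2 : ℤ) : ℂ) • ρ P1Plus + (2 : ℂ) • (ρ NMinus * ρ XPlus)

/-- The operator `E₋ = (m+2) P₁₋ - 2 N₋ P₀₋` (with parameter `m`). -/
def opEm (ρ : M4C →ₗ[ℂ] Module.End ℂ V) (m : ℤ) : Module.End ℂ V :=
  ((m + 2 : ℤ) : ℂ) • ρ P1Minus - (2 : ℂ) • (ρ NMinus * ρ P0Minus)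

/-- The operator `D₊ = P₁₊² - 4 X₊ P₀₊`. -/
def opDp (ρ : M4C →ₗ[ℂ] Module.End ℂ V) : Module.End ℂ V :=
  (ρ P1Plus) ^ 2 - (4 : ℂ) • (ρ XPlus * ρ P0Plus)

/-- The operator `D₋ = P₁₋² - 4 X₋ P₀₋`. -/
def opDm (ρ : M4C →ₗ[ℂ] Module.End ℂ V) : Module.End ℂ V :=
  (ρ P1Minus) ^ 2 - (4 : ℂ) • (ρ XMinus * ρ P0Minus)

/-- The Casimir element `Ω₂` acting through `ρ`. -/
def casimir (ρ : M4C →ₗ[ℂ] Module.End ℂ V) : Module.End ℂ V :=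
  ((1:ℂ)/2) • (ρ ZM * ρ ZM) + ((1:ℂ)/2) • (ρ ZM' * ρ ZM')
    - ((1:ℂ)/2) • (ρ NPlus * ρ NMinus + ρ NMinus * ρ NPlus)
    + (ρ XPlus * ρ XMinus + ρ XMinus * ρ XPlus)
    + ((1:ℂ)/2) • (ρ P1Plus * ρ P1Minus + ρ P1Minus * ρ P1Plus)
    + (ρ P0Plus * ρ P0Minus + ρ P0Minus * ρ P0Plus)

/-- The space of highest weight vectors of weight `(x, y)`: vectors `v` with
`Z v = x v`, `Z′ v = y v`, `N₊ v = 0`. -/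
def hwSpace (ρ : M4C →ₗ[ℂ] Module.End ℂ V) (x y : ℤ) : Submodule ℂ V :=
  Module.End.eigenspace (ρ ZM) (x : ℂ) ⊓ Module.End.eigenspace (ρ ZM') (y : ℂ)
    ⊓ LinearMap.ker (ρ NPlus)

/-- The sequence `w_i = U^i w`, starting from a vector of weight `(ℓ+m, ℓ)`, with the
parameter of `U` updated to match the weight of its argument at each step. -/
def wseq (ρ : M4C →ₗ[ℂ] Module.End ℂ V) (w : V) (m : ℕ) : ℕ → V
  | 0 => w
  | i + 1 => opU ρ ((m : ℤ) - 2 * i) (wseq ρ w m i)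

/-- The span of the highest weight vectors whose weight `(x, y)` satisfies
`x ≡ lm + r (mod 2)`. -/
def parSpace (ρ : M4C →ₗ[ℂ] Module.End ℂ V) (lm : ℤ) (r : ℤ) : Submodule ℂ V :=
  Submodule.span ℂ {v : V | ∃ x y : ℤ, ρ ZM v = (x : ℂ) • v ∧ ρ ZM' v = (y : ℂ) • v ∧
    ρ NPlus v = 0 ∧ (x - lm) % 2 = r}

/-- The global form of the operator `E₊`, agreeing with `E₊` (with parameter `m = x - y`)
on every vector of weight `(x, y)`. -/
def opEpGlobal (ρ : M4C →ₗ[ℂ] Module.End ℂ V) : Module.End ℂ V :=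
  ρ P1Plus * (ρ ZM - ρ ZM' + 2) + (2 : ℂ) • (ρ NMinus * ρ XPlus)

/-! ### Commutation relations -/

lemma IsRep.apply_apply {ρ : M4C →ₗ[ℂ] Module.End ℂ V} (hρ : IsRep ρ) {A B C : M4C}
    (hA : A ∈ sp4) (hB : B ∈ sp4) (hC : A * B - B * A = C) (v : V) :
    ρ A (ρ B v) = ρ B (ρ A v) + ρ C v := by
  have := congrArg (fun f => f v) (hρ A hA B hB)
  simp only [hC, LinearMap.sub_apply, Module.End.mul_apply] at this
  rw [this]; abel

lemma ZM_mem_sp4 : ZM ∈ sp4 := by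
  simp only [sp4, Set.mem_ofPred_eq, ZM, J4]
  ext i j; fin_cases i <;> fin_cases j <;> simp [Matrix.mul_apply, Fin.sum_univ_four]

lemma ZM'_mem_sp4 : ZM' ∈ sp4 := by
  simp only [sp4, Set.mem_ofPred_eq, ZM', J4]
  ext i j; fin_cases i <;> fin_cases j <;> simp [Matrix.mul_apply, Fin.sum_univ_four]

lemma NPlus_mem_sp4 : NPlus ∈ sp4 := by
  simp only [sp4, Set.mem_ofPred_eq, NPlus, J4]
  ext i j; fin_cases i <;> fin_cases j <;> simp [Matrix.mul_apply, Fin.sum_univ_four]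

lemma NMinus_mem_sp4 : NMinus ∈ sp4 := by
  simp only [sp4, Set.mem_ofPred_eq, NMinus, J4]
  ext i j; fin_cases i <;> fin_cases j <;> simp [Matrix.mul_apply, Fin.sum_univ_four]

lemma XPlus_mem_sp4 : XPlus ∈ sp4 := by
  simp only [sp4, Set.mem_ofPred_eq, XPlus, J4]
  ext i j; fin_cases i <;> fin_cases j <;> simp [Matrix.mul_apply, Fin.sum_univ_four]

lemma P1Plus_mem_sp4 : P1Plus ∈ sp4 := by
  simp only [sp4, Set.mem_ofPred_eq, P1Plus, J4]
  ext i j; fin_cases i <;> fin_cases j <;> simp [Matrix.mul_apply, Fin.sum_univ_four]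

lemma P0Plus_mem_sp4 : P0Plus ∈ sp4 := by
  simp only [sp4, Set.mem_ofPred_eq, P0Plus, J4]
  ext i j; fin_cases i <;> fin_cases j <;> simp [Matrix.mul_apply, Fin.sum_univ_four]

namespace IsRep

variable {ρ : M4C →ₗ[ℂ] Module.End ℂ V}

lemma P1Plus_XPlus (hρ : IsRep ρ) (v : V) : ρ P1Plus (ρ XPlus v) = ρ XPlus (ρ P1Plus v) := by
  have h : P1Plus * XPlus - XPlus * P1Plus = 0 := by
    simp only [← Matrix.ext_iff, Fin.forall_fin_succ]
    simp [P1Plus, XPlus]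
    grind [Complex.I_mul_I]
  simpa using hρ.apply_apply P1Plus_mem_sp4 XPlus_mem_sp4 h v

lemma P0Plus_XPlus (hρ : IsRep ρ) (v : V) : ρ P0Plus (ρ XPlus v) = ρ XPlus (ρ P0Plus v) := by
  have h : P0Plus * XPlus - XPlus * P0Plus = 0 := by
    simp only [← Matrix.ext_iff, Fin.forall_fin_succ]
    simp [P0Plus, XPlus]
  simpa using hρ.apply_apply P0Plus_mem_sp4 XPlus_mem_sp4 h v

lemma P0Plus_P1Plus (hρ : IsRep ρ) (v : V) : ρ P0Plus (ρ P1Plus v) = ρ P1Plus (ρ P0Plus v) := by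
  have h : P0Plus * P1Plus - P1Plus * P0Plus = 0 := by
    simp only [← Matrix.ext_iff, Fin.forall_fin_succ]
    simp [P0Plus, P1Plus]
    grind [Complex.I_mul_I]
  simpa using hρ.apply_apply P0Plus_mem_sp4 P1Plus_mem_sp4 h v

lemma NPlus_XPlus (hρ : IsRep ρ) (v : V) : ρ NPlus (ρ XPlus v) = ρ XPlus (ρ NPlus v) := by
  have h : NPlus * XPlus - XPlus * NPlus = 0 := by
    simp only [← Matrix.ext_iff, Fin.forall_fin_succ]
    simp [NPlus, XPlus]
    grind [Complex.I_mul_I]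
  simpa using hρ.apply_apply NPlus_mem_sp4 XPlus_mem_sp4 h v

lemma NPlus_P1Plus (hρ : IsRep ρ) (v : V) :
    ρ NPlus (ρ P1Plus v) = ρ P1Plus (ρ NPlus v) + (2 : ℂ) • ρ XPlus v := by
  have h : NPlus * P1Plus - P1Plus * NPlus = (2 : ℂ) • XPlus := by
    simp only [← Matrix.ext_iff, Fin.forall_fin_succ]
    simp [NPlus, P1Plus, XPlus]
    grind [Complex.I_mul_I]
  simpa using hρ.apply_apply NPlus_mem_sp4 P1Plus_mem_sp4 h v

lemma NPlus_P0Plus (hρ : IsRep ρ) (v : V) :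
    ρ NPlus (ρ P0Plus v) = ρ P0Plus (ρ NPlus v) + ρ P1Plus v := by
  have h : NPlus * P0Plus - P0Plus * NPlus = P1Plus := by
    simp only [← Matrix.ext_iff, Fin.forall_fin_succ]
    simp [NPlus, P0Plus, P1Plus]
    grind [Complex.I_mul_I]
  exact hρ.apply_apply NPlus_mem_sp4 P0Plus_mem_sp4 h v

lemma NPlus_NMinus (hρ : IsRep ρ) (v : V) :
    ρ NPlus (ρ NMinus v) = ρ NMinus (ρ NPlus v) - (ρ ZM v - ρ ZM' v) := by
  have h : NPlus * NMinus - NMinus * NPlus = ZM' - ZM := by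
    simp only [← Matrix.ext_iff, Fin.forall_fin_succ]
    simp [NPlus, NMinus, ZM, ZM']
    grind [Complex.I_mul_I]
  rw [hρ.apply_apply NPlus_mem_sp4 NMinus_mem_sp4 h v, map_sub, LinearMap.sub_apply]
  abel

lemma NMinus_XPlus (hρ : IsRep ρ) (v : V) :
    ρ NMinus (ρ XPlus v) = ρ XPlus (ρ NMinus v) - ρ P1Plus v := by
  have h : NMinus * XPlus - XPlus * NMinus = -P1Plus := by
    simp only [← Matrix.ext_iff, Fin.forall_fin_succ]
    simp [NMinus, P1Plus, XPlus]
    grind [Complex.I_mul_I]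
  rw [hρ.apply_apply NMinus_mem_sp4 XPlus_mem_sp4 h v, map_neg, LinearMap.neg_apply]
  abel

lemma NMinus_P1Plus (hρ : IsRep ρ) (v : V) :
    ρ NMinus (ρ P1Plus v) = ρ P1Plus (ρ NMinus v) - (2 : ℂ) • ρ P0Plus v := by
  have h : NMinus * P1Plus - P1Plus * NMinus = (-2 : ℂ) • P0Plus := by
    simp only [← Matrix.ext_iff, Fin.forall_fin_succ]
    simp [NMinus, P1Plus, P0Plus]
    grind [Complex.I_mul_I]
  rw [hρ.apply_apply NMinus_mem_sp4 P1Plus_mem_sp4 h v, map_smul, LinearMap.smul_apply,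
    neg_smul, sub_eq_add_neg]

lemma NMinus_P0Plus (hρ : IsRep ρ) (v : V) :
    ρ NMinus (ρ P0Plus v) = ρ P0Plus (ρ NMinus v) := by
  have h : NMinus * P0Plus - P0Plus * NMinus = 0 := by
    simp only [← Matrix.ext_iff, Fin.forall_fin_succ]
    simp [NMinus, P0Plus]
    grind [Complex.I_mul_I]
  simpa using hρ.apply_apply NMinus_mem_sp4 P0Plus_mem_sp4 h v

lemma ZM_XPlus (hρ : IsRep ρ) (v : V) :
    ρ ZM (ρ XPlus v) = ρ XPlus (ρ ZM v) + (2 : ℂ) • ρ XPlus v := by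
  have h : ZM * XPlus - XPlus * ZM = (2 : ℂ) • XPlus := by
    simp only [← Matrix.ext_iff, Fin.forall_fin_succ]
    simp [ZM, XPlus]
    grind [Complex.I_mul_I]
  simpa using hρ.apply_apply ZM_mem_sp4 XPlus_mem_sp4 h v

lemma ZM_P1Plus (hρ : IsRep ρ) (v : V) :
    ρ ZM (ρ P1Plus v) = ρ P1Plus (ρ ZM v) + ρ P1Plus v := by
  have h : ZM * P1Plus - P1Plus * ZM = P1Plus := by
    simp only [← Matrix.ext_iff, Fin.forall_fin_succ]
    simp [ZM, P1Plus]
    grind [Complex.I_mul_I]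
  exact hρ.apply_apply ZM_mem_sp4 P1Plus_mem_sp4 h v

lemma ZM_P0Plus (hρ : IsRep ρ) (v : V) : ρ ZM (ρ P0Plus v) = ρ P0Plus (ρ ZM v) := by
  have h : ZM * P0Plus - P0Plus * ZM = 0 := by
    simp only [← Matrix.ext_iff, Fin.forall_fin_succ]
    simp [ZM, P0Plus]
  simpa using hρ.apply_apply ZM_mem_sp4 P0Plus_mem_sp4 h v

lemma ZM_NMinus (hρ : IsRep ρ) (v : V) :
    ρ ZM (ρ NMinus v) = ρ NMinus (ρ ZM v) - ρ NMinus v := by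
  have h : ZM * NMinus - NMinus * ZM = -NMinus := by
    simp only [← Matrix.ext_iff, Fin.forall_fin_succ]
    simp [ZM, NMinus]
    grind [Complex.I_mul_I]
  rw [hρ.apply_apply ZM_mem_sp4 NMinus_mem_sp4 h v, map_neg, LinearMap.neg_apply,
    sub_eq_add_neg]

lemma ZM'_XPlus (hρ : IsRep ρ) (v : V) : ρ ZM' (ρ XPlus v) = ρ XPlus (ρ ZM' v) := by
  have h : ZM' * XPlus - XPlus * ZM' = 0 := by
    simp only [← Matrix.ext_iff, Fin.forall_fin_succ]
    simp [ZM', XPlus]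
  simpa using hρ.apply_apply ZM'_mem_sp4 XPlus_mem_sp4 h v

lemma ZM'_P1Plus (hρ : IsRep ρ) (v : V) :
    ρ ZM' (ρ P1Plus v) = ρ P1Plus (ρ ZM' v) + ρ P1Plus v := by
  have h : ZM' * P1Plus - P1Plus * ZM' = P1Plus := by
    simp only [← Matrix.ext_iff, Fin.forall_fin_succ]
    simp [ZM', P1Plus]
    grind [Complex.I_mul_I]
  exact hρ.apply_apply ZM'_mem_sp4 P1Plus_mem_sp4 h v

lemma ZM'_P0Plus (hρ : IsRep ρ) (v : V) :
    ρ ZM' (ρ P0Plus v) = ρ P0Plus (ρ ZM' v) + (2 : ℂ) • ρ P0Plus v := by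
  have h : ZM' * P0Plus - P0Plus * ZM' = (2 : ℂ) • P0Plus := by
    simp only [← Matrix.ext_iff, Fin.forall_fin_succ]
    simp [ZM', P0Plus]
    grind [Complex.I_mul_I]
  simpa using hρ.apply_apply ZM'_mem_sp4 P0Plus_mem_sp4 h v

lemma ZM'_NMinus (hρ : IsRep ρ) (v : V) :
    ρ ZM' (ρ NMinus v) = ρ NMinus (ρ ZM' v) + ρ NMinus v := by
  have h : ZM' * NMinus - NMinus * ZM' = NMinus := by
    simp only [← Matrix.ext_iff, Fin.forall_fin_succ]
    simp [ZM', NMinus]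
    grind [Complex.I_mul_I]
  exact hρ.apply_apply ZM'_mem_sp4 NMinus_mem_sp4 h v

end IsRep

/-! ### The polynomial model -/

namespace SymModel

open MvPolynomial

/-- The symmetric algebra of `𝔭₊`; the variables `0`, `1`, `2` stand for `X₊`, `P₁₊`, `P₀₊`. -/
abbrev Poly := MvPolynomial (Fin 3) ℂ

/-- The derivation of the symmetric algebra induced by the adjoint action of `N₊`. -/
def raise : Derivation ℂ Poly Poly := mkDerivation ℂ ![0, 2 * X 0, X 1]

/-- The derivation of the symmetric algebra induced by the adjoint action of `N₋`. -/
def lower : Derivation ℂ Poly Poly := mkDerivation ℂ ![-X 1, -(2 * X 2), 0]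

/-- The discriminant, i.e. the polynomial of `D₊`. -/
def disc : Poly := X 1 ^ 2 - 4 * (X 0 * X 2)

@[simp] lemma raise_X0 : raise (X 0) = 0 := by simp [raise, mkDerivation_X]
@[simp] lemma raise_X1 : raise (X 1) = 2 * X 0 := by simp [raise, mkDerivation_X]
@[simp] lemma raise_X2 : raise (X 2) = X 1 := by simp [raise, mkDerivation_X]
@[simp] lemma lower_X0 : lower (X 0) = -X 1 := by simp [lower, mkDerivation_X]
@[simp] lemma lower_X1 : lower (X 1) = -(2 * X 2) := by simp [lower, mkDerivation_X]
@[simp] lemma lower_X2 : lower (X 2) = 0 := by simp [lower, mkDerivation_X]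

lemma derivation_four (d : Derivation ℂ Poly Poly) : d 4 = 0 := by
  simpa using d.map_natCast 4

@[simp] lemma raise_disc : raise disc = 0 := by
  simp only [disc, map_sub, Derivation.leibniz, Derivation.leibniz_pow, raise_X0, raise_X1,
    raise_X2, derivation_four, smul_eq_mul, nsmul_eq_mul]
  push_cast; ring

@[simp] lemma lower_disc : lower disc = 0 := by
  simp only [disc, map_sub, Derivation.leibniz, Derivation.leibniz_pow, lower_X0, lower_X1,
    lower_X2, derivation_four, smul_eq_mul, nsmul_eq_mul]
  push_cast; ring

/-- The monomials `X^a disc^b`. -/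
def inv (a b : ℕ) : Poly := X 0 ^ a * disc ^ b

lemma inv_mul_inv (a b c d : ℕ) : inv a b * inv c d = inv (a + c) (b + d) := by
  simp only [inv, pow_add]; ring

lemma raise_inv (a b : ℕ) : raise (inv a b) = 0 := by
  simp [inv, Derivation.leibniz, Derivation.leibniz_pow]

lemma lower_inv (a b : ℕ) : lower (inv (a + 1) b) = -((a + 1 : ℕ) : Poly) * X 1 * inv a b := by
  simp only [inv, Derivation.leibniz, Derivation.leibniz_pow, lower_disc, lower_X0, smul_eq_mul,
    nsmul_eq_mul, Nat.add_sub_cancel]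
  ring

lemma raise_pow_inv_mul (n a b : ℕ) (f : Poly) :
    ((raise : Poly →ₗ[ℂ] Poly) ^ n) (inv a b * f) =
      inv a b * ((raise : Poly →ₗ[ℂ] Poly) ^ n) f := by
  induction n with
  | zero => simp
  | succ n ih =>
    rw [pow_succ', Module.End.mul_apply, ih, Module.End.mul_apply]
    simp [Derivation.leibniz, raise_inv]

lemma linearIndependent_inv : LinearIndependent ℂ (fun p : ℕ × ℕ => inv p.1 p.2) := by
  let φ : Poly →ₐ[ℂ] MvPolynomial (Fin 2) ℂ := aeval ![X 0, X 1, 0]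
  refine LinearIndependent.of_comp φ.toLinearMap ?_
  have h : (φ.toLinearMap ∘ fun p : ℕ × ℕ => inv p.1 p.2) =
      (basisMonomials (Fin 2) ℂ) ∘ fun p : ℕ × ℕ =>
        Finsupp.single 0 p.1 + Finsupp.single 1 (2 * p.2) := by
    funext p
    simp [φ, inv, disc, monomial_eq, ← pow_mul]
  rw [h]
  refine (basisMonomials (Fin 2) ℂ).linearIndependent.comp _ ?_
  intro p q hpq
  have h0 := DFunLike.congr_fun hpq 0
  have h1 := DFunLike.congr_fun hpq 1
  simp at h0 h1
  exact Prod.ext h0 h1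

/-- The polynomials `P₀^i` and `P₁ P₀^i`, ordered by degree in the `𝔰𝔩₂`-sense. -/
def mid (n : ℕ) : Poly := X 1 ^ (n % 2) * X 2 ^ (n / 2)

lemma mid_even (i : ℕ) : mid (2 * i) = X 2 ^ i := by
  simp [mid]

lemma mid_odd (i : ℕ) : mid (2 * i + 1) = X 1 * X 2 ^ i := by
  have h1 : (2 * i + 1) % 2 = 1 := by omega
  have h2 : (2 * i + 1) / 2 = i := by omega
  simp [mid, h1, h2]

lemma raise_pow_step {n e : ℕ} {c : ℂ} (hc : c ≠ 0) {p q r : Poly}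
    (hp : raise p = c • (inv e 0 * q) + r)
    (hr : ((raise : Poly →ₗ[ℂ] Poly) ^ n) r = 0)
    (hq : ∃ c' : ℂ, c' ≠ 0 ∧ ∃ j, ((raise : Poly →ₗ[ℂ] Poly) ^ n) q = c' • inv j 0) :
    ∃ c' : ℂ, c' ≠ 0 ∧ ∃ j, ((raise : Poly →ₗ[ℂ] Poly) ^ (n + 1)) p = c' • inv j 0 := by
  obtain ⟨c', hc', j, hj⟩ := hq
  refine ⟨c * c', mul_ne_zero hc hc', e + j, ?_⟩
  rw [pow_succ, Module.End.mul_apply, Derivation.coeFn_coe, hp, map_add, map_smul,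
    raise_pow_inv_mul, hr, hj, add_zero, mul_smul_comm, inv_mul_inv, smul_smul]

lemma raise_mid_even (i : ℕ) :
    raise (mid (2 * i + 2)) = ((i + 1 : ℕ) : ℂ) • (inv 0 0 * mid (2 * i + 1)) + 0 := by
  rw [show 2 * i + 2 = 2 * (i + 1) by ring, mid_even, mid_odd]
  simp only [inv, Derivation.leibniz_pow, raise_X2, Nat.add_sub_cancel, smul_eq_mul,
    nsmul_eq_mul, smul_eq_C_mul, map_natCast]
  ring

lemma raise_mid_odd (i : ℕ) :
    raise (mid (2 * i + 3)) = ((4 * i + 6 : ℕ) : ℂ) • (inv 1 0 * mid (2 * i + 2)) +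
      ((i + 1 : ℕ) : ℂ) • (inv 0 1 * mid (2 * i)) := by
  rw [show 2 * i + 3 = 2 * (i + 1) + 1 by ring, show 2 * i + 2 = 2 * (i + 1) by ring, mid_odd,
    mid_even, mid_even]
  simp only [inv, Derivation.leibniz, Derivation.leibniz_pow, raise_X2, raise_X1,
    Nat.add_sub_cancel, smul_eq_mul, nsmul_eq_mul, smul_eq_C_mul, map_natCast, disc]
  push_cast; ring

lemma raise_pow_mid (n : ℕ) :
    ∃ c : ℂ, c ≠ 0 ∧ ∃ j, ((raise : Poly →ₗ[ℂ] Poly) ^ n) (mid n) = c • inv j 0 := by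
  have key : ∀ n q, (∃ c : ℂ, c ≠ 0 ∧ ∃ j, ((raise : Poly →ₗ[ℂ] Poly) ^ n) q = c • inv j 0) →
      ((raise : Poly →ₗ[ℂ] Poly) ^ (n + 1)) q = 0 := by
    rintro n q ⟨c, -, j, hj⟩
    rw [pow_succ', Module.End.mul_apply, hj]
    simp [raise_inv]
  induction n using Nat.strong_induction_on with
  | _ n ih =>
    match n, ih with
    | 0, _ => exact ⟨1, one_ne_zero, 0, by simp [mid, inv]⟩
    | 1, ih =>
      refine raise_pow_step (c := 2) two_ne_zero (e := 1) (q := mid 0) (r := 0) ?_ (by simp)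
        (ih 0 (by omega))
      simp [mid, inv, smul_eq_C_mul, map_ofNat]
    | n + 2, ih =>
      obtain ⟨i, rfl | rfl⟩ : ∃ i, n = 2 * i ∨ n = 2 * i + 1 := ⟨n / 2, by omega⟩
      · exact raise_pow_step (Nat.cast_ne_zero.2 (by omega)) (raise_mid_even i) (by simp)
          (ih _ (by omega))
      · refine raise_pow_step (Nat.cast_ne_zero.2 (by omega)) (raise_mid_odd i) ?_
          (ih _ (by omega))
        rw [map_smul, raise_pow_inv_mul, pow_succ', Module.End.mul_apply,
          key _ _ (ih (2 * i) (by omega))]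
        simp

lemma raise_pow_mid_of_lt {k n : ℕ} (h : n < k) :
    ((raise : Poly →ₗ[ℂ] Poly) ^ k) (mid n) = 0 := by
  obtain ⟨c, -, j, hj⟩ := raise_pow_mid n
  obtain ⟨i, rfl⟩ := Nat.exists_eq_add_of_lt h
  rw [show n + i + 1 = i + (1 + n) by ring, pow_add, pow_add, Module.End.mul_apply,
    Module.End.mul_apply, hj]
  simp [raise_inv]

/-- The basis `X^a disc^b P₁^ε P₀^i` (`n = 2 i + ε`, `ε ∈ {0, 1}`). -/
def fam (t : ℕ × ℕ × ℕ) : Poly := inv t.1 t.2.1 * mid t.2.2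

lemma coeff_eq_zero_of_raise_pow {k : ℕ} {g : ℕ × ℕ × ℕ →₀ ℂ}
    (hg : ((raise : Poly →ₗ[ℂ] Poly) ^ k) (Finsupp.linearCombination ℂ fam g) = 0)
    (t : ℕ × ℕ × ℕ) (ht : k ≤ t.2.2) : g t = 0 := by
  by_contra hgt
  obtain ⟨s, hs, hmax⟩ := g.support.exists_max_image (fun t => t.2.2)
    ⟨t, Finsupp.mem_support_iff.2 hgt⟩
  have hks : k ≤ s.2.2 := ht.trans (hmax t (Finsupp.mem_support_iff.2 hgt))
  obtain ⟨c, hc, j, hj⟩ := raise_pow_mid s.2.2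
  have h0 : ((raise : Poly →ₗ[ℂ] Poly) ^ s.2.2) (Finsupp.linearCombination ℂ fam g) = 0 := by
    rw [← Nat.sub_add_cancel hks, pow_add, Module.End.mul_apply, hg, map_zero]
  rw [Finsupp.linearCombination_apply, Finsupp.sum, map_sum] at h0
  have h1 : ∑ u ∈ g.support with u.2.2 = s.2.2, (g u * c) • inv (u.1 + j) u.2.1 = 0 := by
    rw [← h0, Finset.sum_filter]
    refine Finset.sum_congr rfl fun u hu => ?_
    rw [map_smul, fam, raise_pow_inv_mul]
    split_ifs with h
    · rw [h, hj, mul_smul_comm, inv_mul_inv, smul_smul, add_zero]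
    · rw [raise_pow_mid_of_lt (lt_of_le_of_ne (hmax u hu) h), mul_zero, smul_zero]
  have h2 : LinearIndependent ℂ
      (fun u : {u : ℕ × ℕ × ℕ // u.2.2 = s.2.2} => inv (u.1.1 + j) u.1.2.1) := by
    refine linearIndependent_inv.comp
      (fun u : {u : ℕ × ℕ × ℕ // u.2.2 = s.2.2} => (u.1.1 + j, u.1.2.1)) ?_
    rintro ⟨⟨a, b, d⟩, h⟩ ⟨⟨a', b', d'⟩, h'⟩ heq
    simp only [Subtype.mk.injEq, Prod.mk.injEq] at h h' heq ⊢
    omega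
  rw [← Finset.sum_subtype_eq_sum_filter] at h1
  have h3 := linearIndependent_iff'.1 h2 _ (fun u => g u.1 * c) h1 ⟨s, rfl⟩
    (Finset.mem_subtype.2 hs)
  exact mul_ne_zero (Finsupp.mem_support_iff.1 hs) hc h3

lemma linearIndependent_fam : LinearIndependent ℂ fam := by
  refine linearIndependent_iff.2 fun g hg => ?_
  ext t
  exact coeff_eq_zero_of_raise_pow (k := 0) (by simpa using hg) t (Nat.zero_le _)

lemma span_fam : Submodule.span ℂ (Set.range fam) = ⊤ := by
  have key : ∀ i, ∀ p ∈ Submodule.span ℂ (Set.range fam),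
      p * X i ∈ Submodule.span ℂ (Set.range fam) := by
    intro i p hp
    induction hp using Submodule.span_induction with
    | zero => simp
    | add p q _ _ hp hq => rw [add_mul]; exact add_mem hp hq
    | smul c p _ hp => rw [smul_mul_assoc]; exact Submodule.smul_mem _ _ hp
    | mem p hp =>
      obtain ⟨⟨a, b, n⟩, rfl⟩ := hp
      have hmem : ∀ t, fam t ∈ Submodule.span ℂ (Set.range fam) :=
        fun t => Submodule.subset_span ⟨t, rfl⟩
      fin_cases i
      · convert hmem (a + 1, b, n) using 1
        simp only [fam, inv, Fin.zero_eta, pow_succ]; ring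
      · obtain ⟨i, rfl | rfl⟩ : ∃ i, n = 2 * i ∨ n = 2 * i + 1 := ⟨n / 2, by omega⟩
        · convert hmem (a, b, 2 * i + 1) using 1
          simp only [fam, mid_even, mid_odd, Fin.mk_one]; ring
        · convert add_mem (hmem (a, b + 1, 2 * i)) (Submodule.smul_mem _ (4 : ℂ)
            (hmem (a + 1, b, 2 * (i + 1)))) using 1
          simp only [fam, mid_even, mid_odd, Fin.mk_one, inv, smul_eq_C_mul, map_ofNat, disc]
          ring
      · convert hmem (a, b, n + 2) using 1
        simp only [fam, mid, Fin.reduceFinMk, Nat.add_mod_right,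
          Nat.add_div_right n (show 0 < 2 by norm_num), pow_succ]
        ring
  refine eq_top_iff.2 fun p _ => ?_
  induction p using MvPolynomial.induction_on with
  | C c =>
    have : C c = c • fam (0, 0, 0) := by simp [fam, inv, mid, smul_eq_C_mul]
    rw [this]
    exact Submodule.smul_mem _ _ (Submodule.subset_span ⟨_, rfl⟩)
  | add p q hp hq => exact add_mem (hp trivial) (hq trivial)
  | mul_X p i hp => exact key i p (hp trivial)

lemma mem_span_fam_of_raise_pow {k : ℕ} {f : Poly}
    (hf : ((raise : Poly →ₗ[ℂ] Poly) ^ k) f = 0) :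
    f ∈ Submodule.span ℂ (fam '' {t | t.2.2 < k}) := by
  have hmem : f ∈ Submodule.span ℂ (Set.range fam) := span_fam ▸ Submodule.mem_top
  obtain ⟨g, rfl⟩ := Finsupp.mem_span_range_iff_exists_finsupp.1 hmem
  refine Submodule.sum_mem _ fun t ht => Submodule.smul_mem _ _ (Submodule.subset_span ⟨t, ?_, rfl⟩)
  by_contra h
  exact Finsupp.mem_support_iff.1 ht (coeff_eq_zero_of_raise_pow hf t (not_lt.1 h))

end SymModel

/-! ### Highest weight vectors -/

/-- `v` has weight `(x, y)` and is annihilated by `N₊`. -/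
structure IsHWVec (ρ : M4C →ₗ[ℂ] Module.End ℂ V) (x y : ℂ) (v : V) : Prop where
  wtZ : ρ ZM v = x • v
  wtZ' : ρ ZM' v = y • v
  annNPlus : ρ NPlus v = 0

namespace IsHWVec

variable {ρ : M4C →ₗ[ℂ] Module.End ℂ V} {x y : ℂ} {v : V}

lemma xPlus (hv : IsHWVec ρ x y v) (hρ : IsRep ρ) : IsHWVec ρ (x + 2) y (ρ XPlus v) where
  wtZ := by rw [hρ.ZM_XPlus, hv.wtZ, map_smul, add_smul]
  wtZ' := by rw [hρ.ZM'_XPlus, hv.wtZ', map_smul]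
  annNPlus := by rw [hρ.NPlus_XPlus, hv.annNPlus, map_zero]

lemma dPlus (hv : IsHWVec ρ x y v) (hρ : IsRep ρ) :
    IsHWVec ρ (x + 2) (y + 2) (opDp ρ v) where
  wtZ := by
    simp only [opDp, pow_two, LinearMap.sub_apply, LinearMap.smul_apply, Module.End.mul_apply,
      map_sub, map_smul, map_add, hρ.ZM_P1Plus, hρ.ZM_XPlus, hρ.ZM_P0Plus, hv.wtZ]
    module
  wtZ' := by
    simp only [opDp, pow_two, LinearMap.sub_apply, LinearMap.smul_apply, Module.End.mul_apply,
      map_sub, map_smul, map_add, hρ.ZM'_P1Plus, hρ.ZM'_XPlus, hρ.ZM'_P0Plus, hv.wtZ']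
    module
  annNPlus := by
    simp only [opDp, pow_two, LinearMap.sub_apply, LinearMap.smul_apply, Module.End.mul_apply,
      map_sub, map_smul, map_add, hρ.NPlus_P1Plus, hρ.NPlus_XPlus, hρ.NPlus_P0Plus,
      hρ.P1Plus_XPlus, hv.annNPlus, map_zero]
    module

lemma opU (hv : IsHWVec ρ x y v) (hρ : IsRep ρ) {μ : ℤ} (hμ : x - y = μ) :
    IsHWVec ρ x (y + 2) (opU ρ μ v) where
  wtZ := by
    simp only [_root_.opU, pow_two, LinearMap.add_apply, LinearMap.smul_apply,
      Module.End.mul_apply, map_sub, map_smul, map_add, hρ.ZM_P1Plus, hρ.ZM_XPlus,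
      hρ.ZM_P0Plus, hρ.ZM_NMinus, hv.wtZ]
    module
  wtZ' := by
    simp only [_root_.opU, pow_two, LinearMap.add_apply, LinearMap.smul_apply,
      Module.End.mul_apply, map_smul, map_add, hρ.ZM'_P1Plus, hρ.ZM'_XPlus,
      hρ.ZM'_P0Plus, hρ.ZM'_NMinus, hv.wtZ']
    module
  annNPlus := by
    obtain rfl := sub_eq_iff_eq_add.1 hμ
    simp only [_root_.opU, pow_two, LinearMap.add_apply, LinearMap.smul_apply,
      Module.End.mul_apply, map_sub, map_smul, map_add, hρ.NPlus_P1Plus, hρ.NPlus_XPlus,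
      hρ.NPlus_P0Plus, hρ.NPlus_NMinus, hρ.ZM_NMinus, hρ.ZM'_NMinus, hv.wtZ, hv.wtZ',
      hv.annNPlus, map_zero]
    push_cast
    module

lemma opEpGlobal_apply (hv : IsHWVec ρ x y v) :
    opEpGlobal ρ v = (x - y + 2) • ρ P1Plus v + (2 : ℂ) • ρ NMinus (ρ XPlus v) := by
  have h2 : (2 : Module.End ℂ V) v = (2 : ℂ) • v := by
    rw [ofNat_smul_eq_nsmul]; rfl
  simp only [opEpGlobal, LinearMap.add_apply, LinearMap.sub_apply, LinearMap.smul_apply,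
    Module.End.mul_apply, hv.wtZ, hv.wtZ', h2, map_add, map_sub, map_smul]
  module

lemma opEpGlobal (hv : IsHWVec ρ x y v) (hρ : IsRep ρ) :
    IsHWVec ρ (x + 1) (y + 1) (opEpGlobal ρ v) := by
  rw [hv.opEpGlobal_apply]
  refine ⟨?_, ?_, ?_⟩
  · simp only [map_smul, map_add, hρ.ZM_P1Plus, hρ.ZM_XPlus, hρ.ZM_NMinus, hv.wtZ]
    module
  · simp only [map_smul, map_add, hρ.ZM'_P1Plus, hρ.ZM'_XPlus, hρ.ZM'_NMinus, hv.wtZ']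
    module
  · simp only [map_smul, map_add, map_zero, hρ.NPlus_P1Plus, hρ.NPlus_XPlus,
      hρ.NPlus_NMinus, hρ.ZM_XPlus, hρ.ZM'_XPlus, hv.wtZ, hv.wtZ', hv.annNPlus]
    module

end IsHWVec

/-! ### Coordinates on the parabolic Verma module -/

namespace IsVerma

open SymModel MvPolynomial

variable {k l : ℤ} {ρ : M4C →ₗ[ℂ] Module.End ℂ V} {w : V}

/-- The PBW basis. -/
def basis (h : IsVerma k l ρ w) :
    Module.Basis {t : ℕ × ℕ × ℕ × ℕ // (t.2.2.2 : ℤ) ≤ k - l} ℂ V :=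
  Module.Basis.mk h.indep fun v _ => h.spans v

lemma basis_apply (h : IsVerma k l ρ w)
    (t : {t : ℕ × ℕ × ℕ × ℕ // (t.2.2.2 : ℤ) ≤ k - l}) : h.basis t = pbwVec ρ w t.1 := by
  simp [basis]

/-- The `S(𝔭₊)`-coefficient of a vector at `N₋^d w`. -/
def coord (h : IsVerma k l ρ w) (d : ℕ) : V →ₗ[ℂ] Poly :=
  h.basis.constr ℂ fun t =>
    if t.1.2.2.2 = d then X 0 ^ t.1.1 * X 1 ^ t.1.2.1 * X 2 ^ t.1.2.2.1 else 0

lemma coord_pbwVec (h : IsVerma k l ρ w) (d : ℕ) (t : ℕ × ℕ × ℕ × ℕ)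
    (ht : (t.2.2.2 : ℤ) ≤ k - l) :
    h.coord d (pbwVec ρ w t) =
      if t.2.2.2 = d then X 0 ^ t.1 * X 1 ^ t.2.1 * X 2 ^ t.2.2.1 else 0 := by
  rw [← h.basis_apply ⟨t, ht⟩, coord, Module.Basis.constr_basis]

lemma coord_XPlus (h : IsVerma k l ρ w) (d : ℕ) (v : V) :
    h.coord d (ρ XPlus v) = X 0 * h.coord d v := by
  suffices h.coord d ∘ₗ ρ XPlus = LinearMap.mulLeft ℂ (X 0) ∘ₗ h.coord d from
    LinearMap.congr_fun this v
  refine h.basis.ext fun ⟨⟨a, b, c, e⟩, ht⟩ => ?_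
  have : ρ XPlus (pbwVec ρ w (a, b, c, e)) = pbwVec ρ w (a + 1, b, c, e) := by
    simp only [pbwVec, pow_succ' _ a, Module.End.mul_apply]
  simp only [LinearMap.comp_apply, basis_apply, this, LinearMap.mulLeft_apply]
  rw [h.coord_pbwVec d (a + 1, b, c, e) ht, h.coord_pbwVec d _ ht, mul_ite, mul_zero]
  simp only [pow_succ', mul_assoc]

lemma coord_P1Plus (h : IsVerma k l ρ w) (d : ℕ) (v : V) :
    h.coord d (ρ P1Plus v) = X 1 * h.coord d v := by
  suffices h.coord d ∘ₗ ρ P1Plus = LinearMap.mulLeft ℂ (X 1) ∘ₗ h.coord d from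
    LinearMap.congr_fun this v
  refine h.basis.ext fun ⟨⟨a, b, c, e⟩, ht⟩ => ?_
  have hc : Commute (ρ P1Plus) (ρ XPlus ^ a) :=
    Commute.pow_right (LinearMap.ext fun v => h.rep.P1Plus_XPlus v) a
  have : ρ P1Plus (pbwVec ρ w (a, b, c, e)) = pbwVec ρ w (a, b + 1, c, e) := by
    simp only [pbwVec, pow_succ' _ b, ← Module.End.mul_apply, ← mul_assoc, hc.eq]
  simp only [LinearMap.comp_apply, basis_apply, this, LinearMap.mulLeft_apply]
  rw [h.coord_pbwVec d (a, b + 1, c, e) ht, h.coord_pbwVec d _ ht, mul_ite, mul_zero]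
  simp only [pow_succ', mul_left_comm, mul_assoc]

lemma coord_P0Plus (h : IsVerma k l ρ w) (d : ℕ) (v : V) :
    h.coord d (ρ P0Plus v) = X 2 * h.coord d v := by
  suffices h.coord d ∘ₗ ρ P0Plus = LinearMap.mulLeft ℂ (X 2) ∘ₗ h.coord d from
    LinearMap.congr_fun this v
  refine h.basis.ext fun ⟨⟨a, b, c, e⟩, ht⟩ => ?_
  have hc : Commute (ρ P0Plus) (ρ XPlus ^ a * ρ P1Plus ^ b) :=
    (Commute.pow_right (LinearMap.ext fun v => h.rep.P0Plus_XPlus v) a).mul_right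
      (Commute.pow_right (LinearMap.ext fun v => h.rep.P0Plus_P1Plus v) b)
  have : ρ P0Plus (pbwVec ρ w (a, b, c, e)) = pbwVec ρ w (a, b, c + 1, e) := by
    simp only [pbwVec, pow_succ' _ c]
    rw [← Module.End.mul_apply, mul_assoc _ (ρ P0Plus ^ c), ← mul_assoc, hc.eq]
    simp only [mul_assoc]
  simp only [LinearMap.comp_apply, basis_apply, this, LinearMap.mulLeft_apply]
  rw [h.coord_pbwVec d (a, b, c + 1, e) ht, h.coord_pbwVec d _ ht, mul_ite, mul_zero]
  simp only [pow_succ']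
  congr 1; ring

lemma coord_opDp (h : IsVerma k l ρ w) (d : ℕ) (v : V) :
    h.coord d (opDp ρ v) = disc * h.coord d v := by
  simp only [opDp, pow_two, LinearMap.sub_apply, LinearMap.smul_apply, Module.End.mul_apply,
    map_sub, map_smul, coord_P1Plus, coord_XPlus, coord_P0Plus, disc, smul_eq_C_mul, map_ofNat]
  ring

lemma NMinus_pow_eq_zero (h : IsVerma k l ρ w) {e : ℕ} (he : k - l < e) :
    (ρ NMinus ^ e) w = 0 := by
  have hle := h.le
  obtain ⟨j, rfl⟩ : ∃ j, e = j + ((k - l).toNat + 1) := ⟨e - ((k - l).toNat + 1), by omega⟩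
  rw [pow_add, Module.End.mul_apply, h.annNMinusPow, map_zero]

lemma coord_NMinus_pow (h : IsVerma k l ρ w) (d e : ℕ) :
    h.coord d ((ρ NMinus ^ e) w) = if e = d ∧ (e : ℤ) ≤ k - l then 1 else 0 := by
  by_cases he : (e : ℤ) ≤ k - l
  · have := h.coord_pbwVec d (0, 0, 0, e) he
    simpa [pbwVec, he] using this
  · rw [h.NMinus_pow_eq_zero (not_le.1 he), map_zero, if_neg (fun h => he h.2)]

lemma coord_eq_zero_of_lt (h : IsVerma k l ρ w) {d : ℕ} (hd : k - l < d) : h.coord d = 0 := by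
  refine h.basis.ext fun ⟨t, ht⟩ => ?_
  rw [basis_apply, h.coord_pbwVec d t ht, if_neg (by omega), LinearMap.zero_apply]

lemma eq_zero_of_coord (h : IsVerma k l ρ w) {v : V} (hv : ∀ d, h.coord d v = 0) : v = 0 := by
  have key : ∀ t : {t : ℕ × ℕ × ℕ × ℕ // (t.2.2.2 : ℤ) ≤ k - l}, h.basis.coord t =
      lcoeff ℂ (Finsupp.single 0 t.1.1 + Finsupp.single 1 t.1.2.1 + Finsupp.single 2 t.1.2.2.1)
        ∘ₗ h.coord t.1.2.2.2 := by
    intro t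
    refine h.basis.ext fun s => ?_
    have hs : (X 0 ^ s.1.1 * X 1 ^ s.1.2.1 * X 2 ^ s.1.2.2.1 : Poly) = monomial
        (Finsupp.single 0 s.1.1 + Finsupp.single 1 s.1.2.1 + Finsupp.single 2 s.1.2.2.1) 1 := by
      simp [X_pow_eq_monomial, monomial_mul]
    rw [LinearMap.comp_apply, basis_apply, h.coord_pbwVec _ _ s.2, hs, ← h.basis_apply,
      Module.Basis.coord_apply, Module.Basis.repr_self, Finsupp.single_apply, apply_ite (lcoeff _ _),
      map_zero, lcoeff_apply, coeff_monomial, ← ite_and]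
    refine if_congr ?_ rfl rfl
    constructor
    · rintro rfl; exact ⟨rfl, rfl⟩
    · rintro ⟨h1, h2⟩
      have e0 := DFunLike.congr_fun h2 0
      have e1 := DFunLike.congr_fun h2 1
      have e2 := DFunLike.congr_fun h2 2
      simp at e0 e1 e2
      exact Subtype.ext (Prod.ext e0 (Prod.ext e1 (Prod.ext e2 h1)))
  refine h.basis.forall_coord_eq_zero_iff.1 fun t => ?_
  rw [key, LinearMap.comp_apply, hv, map_zero]

lemma eq_top_of_closed (h : IsVerma k l ρ w) {p : Submodule ℂ V}
    (hX : ∀ v ∈ p, ρ XPlus v ∈ p) (hP1 : ∀ v ∈ p, ρ P1Plus v ∈ p)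
    (hP0 : ∀ v ∈ p, ρ P0Plus v ∈ p) (hN : ∀ e : ℕ, (e : ℤ) ≤ k - l → (ρ NMinus ^ e) w ∈ p) :
    p = ⊤ := by
  refine eq_top_iff.2 fun v _ => Submodule.span_le.2 ?_ (h.spans v)
  rintro _ ⟨⟨⟨a, b, c, e⟩, ht⟩, rfl⟩
  exact Module.End.pow_apply_mem_of_forall_mem a hX _ (Module.End.pow_apply_mem_of_forall_mem b hP1 _
    (Module.End.pow_apply_mem_of_forall_mem c hP0 _ (hN e ht)))

lemma coord_NMinus (h : IsVerma k l ρ w) (v : V) :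
    h.coord 0 (ρ NMinus v) = lower (h.coord 0 v) := by
  suffices hp : LinearMap.eqLocus (h.coord 0 ∘ₗ ρ NMinus) ((lower : Poly →ₗ[ℂ] Poly) ∘ₗ h.coord 0) = ⊤
    from LinearMap.mem_eqLocus.1 (hp ▸ Submodule.mem_top (x := v))
  refine h.eq_top_of_closed ?_ ?_ ?_ ?_
  · intro v hv
    simp only [LinearMap.mem_eqLocus, LinearMap.comp_apply, Derivation.coeFn_coe] at hv ⊢
    rw [h.rep.NMinus_XPlus, map_sub, coord_XPlus, coord_P1Plus, coord_XPlus, hv,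
      Derivation.leibniz, lower_X0]
    simp only [smul_eq_mul]; ring
  · intro v hv
    simp only [LinearMap.mem_eqLocus, LinearMap.comp_apply, Derivation.coeFn_coe] at hv ⊢
    rw [h.rep.NMinus_P1Plus, map_sub, map_smul, coord_P1Plus, coord_P1Plus, coord_P0Plus, hv,
      Derivation.leibniz, lower_X1]
    simp only [smul_eq_mul, smul_eq_C_mul, map_ofNat]; ring
  · intro v hv
    simp only [LinearMap.mem_eqLocus, LinearMap.comp_apply, Derivation.coeFn_coe] at hv ⊢
    rw [h.rep.NMinus_P0Plus, coord_P0Plus, coord_P0Plus, hv, Derivation.leibniz, lower_X2]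
    simp only [smul_eq_mul]; ring
  · intro e he
    simp only [LinearMap.mem_eqLocus, LinearMap.comp_apply, Derivation.coeFn_coe]
    rw [← Module.End.mul_apply, ← pow_succ', coord_NMinus_pow, coord_NMinus_pow]
    split_ifs <;> simp_all

lemma isHWVec (h : IsVerma k l ρ w) : IsHWVec ρ k l w := ⟨h.wtZ, h.wtZ', h.annNPlus⟩

lemma weight_NMinus_pow (h : IsVerma k l ρ w) (e : ℕ) :
    ρ ZM ((ρ NMinus ^ e) w) - ρ ZM' ((ρ NMinus ^ e) w) =
      ((k - l - 2 * e : ℤ) : ℂ) • (ρ NMinus ^ e) w := by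
  induction e with
  | zero => simp [h.wtZ, h.wtZ', sub_smul]
  | succ e ih =>
    rw [pow_succ', Module.End.mul_apply, h.rep.ZM_NMinus, h.rep.ZM'_NMinus, sub_sub,
      sub_eq_iff_eq_add.1 ih, map_add, map_smul]
    push_cast
    module

lemma NPlus_NMinus_pow (h : IsVerma k l ρ w) (e : ℕ) :
    ρ NPlus ((ρ NMinus ^ (e + 1)) w) =
      (-((e + 1 : ℕ) * (k - l - e : ℤ)) : ℂ) • (ρ NMinus ^ e) w := by
  induction e with
  | zero => simp [h.rep.NPlus_NMinus, h.annNPlus, h.wtZ, h.wtZ', sub_smul]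
  | succ e ih =>
    rw [pow_succ', Module.End.mul_apply, h.rep.NPlus_NMinus, h.weight_NMinus_pow, ih, map_smul,
      ← Module.End.mul_apply, ← pow_succ']
    push_cast
    module

lemma coord_NPlus (h : IsVerma k l ρ w) (d : ℕ) (v : V) :
    h.coord d (ρ NPlus v) =
      raise (h.coord d v) - ((d + 1 : ℕ) * (k - l - d : ℤ) : ℂ) • h.coord (d + 1) v := by
  suffices hp : LinearMap.eqLocus (h.coord d ∘ₗ ρ NPlus) ((raise : Poly →ₗ[ℂ] Poly) ∘ₗ h.coord d -
      ((d + 1 : ℕ) * (k - l - d : ℤ) : ℂ) • h.coord (d + 1)) = ⊤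
    from LinearMap.mem_eqLocus.1 (hp ▸ Submodule.mem_top (x := v))
  refine h.eq_top_of_closed ?_ ?_ ?_ ?_
  · intro v hv
    simp only [LinearMap.mem_eqLocus, LinearMap.comp_apply, Derivation.coeFn_coe,
      LinearMap.sub_apply, LinearMap.smul_apply] at hv ⊢
    rw [h.rep.NPlus_XPlus, coord_XPlus, coord_XPlus, coord_XPlus, hv,
      Derivation.leibniz, raise_X0, mul_sub, mul_smul_comm]
    simp
  · intro v hv
    simp only [LinearMap.mem_eqLocus, LinearMap.comp_apply, Derivation.coeFn_coe,
      LinearMap.sub_apply, LinearMap.smul_apply] at hv ⊢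
    rw [h.rep.NPlus_P1Plus, map_add, map_smul, coord_P1Plus, coord_P1Plus, coord_P1Plus,
      coord_XPlus, hv, Derivation.leibniz, raise_X1, mul_sub, mul_smul_comm]
    simp only [smul_eq_mul, smul_eq_C_mul, map_ofNat]; ring
  · intro v hv
    simp only [LinearMap.mem_eqLocus, LinearMap.comp_apply, Derivation.coeFn_coe,
      LinearMap.sub_apply, LinearMap.smul_apply] at hv ⊢
    rw [h.rep.NPlus_P0Plus, map_add, coord_P0Plus, coord_P0Plus, coord_P0Plus,
      coord_P1Plus, hv, Derivation.leibniz, raise_X2, mul_sub, mul_smul_comm]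
    simp only [smul_eq_mul]; ring
  · intro e he
    simp only [LinearMap.mem_eqLocus, LinearMap.comp_apply, Derivation.coeFn_coe,
      LinearMap.sub_apply, LinearMap.smul_apply]
    have h0 : raise (h.coord d ((ρ NMinus ^ e) w)) = 0 := by
      rw [coord_NMinus_pow]; split_ifs <;> simp
    rw [h0, coord_NMinus_pow]
    cases e with
    | zero => simp [h.annNPlus]
    | succ e =>
      rw [h.NPlus_NMinus_pow, map_smul, coord_NMinus_pow]
      have he' : (e : ℤ) < k - l := by push_cast at he; omega
      by_cases hed : e = d
      · subst hed; simp [he', he'.le]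
      · simp [hed]

lemma raise_coord (h : IsVerma k l ρ w) {v : V} (hv : ρ NPlus v = 0) (d : ℕ) :
    raise (h.coord d v) = ((d + 1 : ℕ) * (k - l - d : ℤ) : ℂ) • h.coord (d + 1) v := by
  have := h.coord_NPlus d v
  rwa [hv, map_zero, eq_comm, sub_eq_zero] at this

lemma eq_zero_of_coord_zero (h : IsVerma k l ρ w) {v : V} (hv : ρ NPlus v = 0)
    (h0 : h.coord 0 v = 0) : v = 0 := by
  refine h.eq_zero_of_coord fun d => ?_
  induction d with
  | zero => exact h0
  | succ d ih =>
    by_cases hd : k - l < (d + 1 : ℕ)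
    · rw [h.coord_eq_zero_of_lt hd, LinearMap.zero_apply]
    · have := h.raise_coord hv d
      rw [ih, map_zero, eq_comm, smul_eq_zero] at this
      refine this.resolve_left (mul_ne_zero (Nat.cast_ne_zero.2 (by omega))
        (Int.cast_ne_zero.2 ?_))
      push_cast at hd; omega

lemma raise_pow_coord_zero (h : IsVerma k l ρ w) {v : V} (hv : ρ NPlus v = 0) {n : ℕ}
    (hn : k - l < n) : ((raise : Poly →ₗ[ℂ] Poly) ^ n) (h.coord 0 v) = 0 := by
  have key : ∀ n : ℕ, ∃ c : ℂ,
      ((raise : Poly →ₗ[ℂ] Poly) ^ n) (h.coord 0 v) = c • h.coord n v := by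
    intro n
    induction n with
    | zero => exact ⟨1, by simp⟩
    | succ n ih =>
      obtain ⟨c, hc⟩ := ih
      exact ⟨_, by rw [pow_succ', Module.End.mul_apply, hc, map_smul, Derivation.coeFn_coe,
        h.raise_coord hv n, smul_smul]⟩
  obtain ⟨c, hc⟩ := key n
  rw [hc, h.coord_eq_zero_of_lt hn, LinearMap.zero_apply, smul_zero]

end IsVerma


/-! ### The vectors `X₊^α D₊^β w_i` -/

/-- The vector `X₊^α D₊^β w_i` for `t = (α, β, i)`. -/
def navVec (ρ : M4C →ₗ[ℂ] Module.End ℂ V) (w : V) (m : ℕ) (t : ℕ × ℕ × ℕ) : V :=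
  (ρ XPlus ^ t.1 * opDp ρ ^ t.2.1) (wseq ρ w m t.2.2)

namespace IsHWVec

variable {ρ : M4C →ₗ[ℂ] Module.End ℂ V} {x y : ℂ} {v : V}

lemma xPlus_pow (hv : IsHWVec ρ x y v) (hρ : IsRep ρ) (a : ℕ) :
    IsHWVec ρ (x + 2 * a) y ((ρ XPlus ^ a) v) := by
  induction a with
  | zero => simpa using hv
  | succ a ih =>
    rw [pow_succ', Module.End.mul_apply]
    convert ih.xPlus hρ using 1
    push_cast; ring

lemma dPlus_pow (hv : IsHWVec ρ x y v) (hρ : IsRep ρ) (b : ℕ) :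
    IsHWVec ρ (x + 2 * b) (y + 2 * b) ((opDp ρ ^ b) v) := by
  induction b with
  | zero => simpa using hv
  | succ b ih =>
    rw [pow_succ', Module.End.mul_apply]
    convert ih.dPlus hρ using 1 <;> (push_cast; ring)

lemma mem_parSpace {lm r x y : ℤ} (hv : IsHWVec ρ x y v) (hr : (x - lm) % 2 = r) :
    v ∈ parSpace ρ lm r :=
  Submodule.subset_span ⟨x, y, hv.wtZ, hv.wtZ', hv.annNPlus, hr⟩

end IsHWVec

lemma parSpace_le_ker (ρ : M4C →ₗ[ℂ] Module.End ℂ V) (lm r : ℤ) :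
    parSpace ρ lm r ≤ LinearMap.ker (ρ NPlus) := by
  refine Submodule.span_le.2 ?_
  rintro v ⟨x, y, -, -, hv, -⟩
  exact hv

lemma disjoint_parSpace (ρ : M4C →ₗ[ℂ] Module.End ℂ V) (lm : ℤ) {r s : ℤ} (hrs : r ≠ s) :
    Disjoint (parSpace ρ lm r) (parSpace ρ lm s) := by
  have key : ∀ r : ℤ, parSpace ρ lm r ≤
      ⨆ x ∈ {x : ℤ | (x - lm) % 2 = r}, Module.End.eigenspace (ρ ZM) (x : ℂ) := by
    intro r
    refine Submodule.span_le.2 ?_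
    rintro v ⟨x, y, hx, -, -, hr⟩
    exact Submodule.mem_iSup_of_mem x (Submodule.mem_iSup_of_mem hr
      (Module.End.mem_eigenspace_iff.2 hx))
  refine Disjoint.mono (key r) (key s) (iSupIndep.disjoint_biSup_biSup
    ((Module.End.eigenspaces_iSupIndep (ρ ZM)).comp Int.cast_injective) ?_)
  exact Set.disjoint_left.2 fun x hr hs => hrs (hr.symm.trans hs)

namespace IsVerma

open SymModel MvPolynomial

section

variable {k l : ℤ} {ρ : M4C →ₗ[ℂ] Module.End ℂ V} {w : V}

lemma coord_XPlus_pow (h : IsVerma k l ρ w) (d a : ℕ) (v : V) :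
    h.coord d ((ρ XPlus ^ a) v) = X 0 ^ a * h.coord d v := by
  induction a with
  | zero => simp
  | succ a ih => rw [pow_succ', Module.End.mul_apply, coord_XPlus, ih, pow_succ', mul_assoc]

lemma coord_opDp_pow (h : IsVerma k l ρ w) (d b : ℕ) (v : V) :
    h.coord d ((opDp ρ ^ b) v) = disc ^ b * h.coord d v := by
  induction b with
  | zero => simp
  | succ b ih => rw [pow_succ', Module.End.mul_apply, coord_opDp, ih, pow_succ', mul_assoc]

lemma coord_opU (h : IsVerma k l ρ w) (μ : ℤ) (v : V) :
    h.coord 0 (opU ρ μ v) = ((μ * (μ - 1) : ℤ) : ℂ) • (X 2 * h.coord 0 v) +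
      ((μ - 1 : ℤ) : ℂ) • (X 1 * lower (h.coord 0 v)) + X 0 * lower (lower (h.coord 0 v)) := by
  simp only [opU, pow_two, LinearMap.add_apply, LinearMap.smul_apply, Module.End.mul_apply,
    map_add, map_smul, coord_P1Plus, coord_XPlus, coord_P0Plus, coord_NMinus]

end

variable {l : ℤ} {m : ℕ} {ρ : M4C →ₗ[ℂ] Module.End ℂ V} {w : V}

lemma isHWVec_wseq (h : IsVerma (l + m) l ρ w) (i : ℕ) :
    IsHWVec ρ (l + m) (l + 2 * i) (wseq ρ w m i) := by
  induction i with
  | zero => simpa [wseq] using h.isHWVec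
  | succ i ih =>
    have := ih.opU h.rep (μ := m - 2 * i) (by push_cast; ring)
    have hy : (l + 2 * (i + 1 : ℕ) : ℂ) = l + 2 * i + 2 := by push_cast; ring
    rw [hy]
    exact this

lemma isHWVec_navVec (h : IsVerma (l + m) l ρ w) (t : ℕ × ℕ × ℕ) :
    IsHWVec ρ (l + m + 2 * t.2.1 + 2 * t.1) (l + 2 * t.2.2 + 2 * t.2.1) (navVec ρ w m t) :=
  ((h.isHWVec_wseq t.2.2).dPlus_pow h.rep t.2.1).xPlus_pow h.rep t.1

lemma exists_coord_wseq (h : IsVerma (l + m) l ρ w) {i : ℕ} (hi : i ≤ m / 2) :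
    ∃ c : ℂ, c ≠ 0 ∧ h.coord 0 (wseq ρ w m i) = c • X 2 ^ i := by
  induction i with
  | zero =>
    have := h.coord_NMinus_pow 0 0
    exact ⟨1, one_ne_zero, by simpa [wseq] using this⟩
  | succ i ih =>
    obtain ⟨c, hc, e⟩ := ih (by omega)
    refine ⟨(((m - 2 * i : ℤ) * ((m - 2 * i : ℤ) - 1) : ℤ) : ℂ) * c,
      mul_ne_zero (Int.cast_ne_zero.2 (mul_ne_zero (by omega) (by omega))) hc, ?_⟩
    rw [wseq, coord_opU, e]
    simp [Derivation.leibniz_pow, smul_smul, pow_succ']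

lemma exists_coord_navVec (h : IsVerma (l + m) l ρ w) {i : ℕ} (hi : i ≤ m / 2) :
    ∃ c : ℂ, c ≠ 0 ∧ ∀ a b : ℕ,
      h.coord 0 (navVec ρ w m (a, b, i)) = c • fam (a, b, 2 * i) ∧
      h.coord 0 (opEpGlobal ρ (navVec ρ w m (a, b, i))) =
        ((m - 2 * i : ℂ) * c) • fam (a, b, 2 * i + 1) := by
  obtain ⟨c, hc, e⟩ := h.exists_coord_wseq hi
  refine ⟨c, hc, fun a b => ?_⟩
  have e1 : h.coord 0 (navVec ρ w m (a, b, i)) = c • (inv a b * X 2 ^ i) := by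
    rw [navVec, Module.End.mul_apply, coord_XPlus_pow, coord_opDp_pow, e, inv,
      mul_smul_comm, mul_smul_comm, mul_assoc]
  refine ⟨by rw [e1, fam, mid_even], ?_⟩
  have e2 : (X 0 * (c • (inv a b * X 2 ^ i)) : Poly) = c • (inv (a + 1) b * X 2 ^ i) := by
    rw [mul_smul_comm, inv, inv, pow_succ']; simp only [mul_assoc]
  rw [(h.isHWVec_navVec _).opEpGlobal_apply, map_add, map_smul, map_smul, coord_P1Plus,
    coord_NMinus, coord_XPlus, e1, e2, fam, mid_odd, Derivation.map_smul, Derivation.leibniz,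
    lower_inv, Derivation.leibniz_pow, lower_X2]
  simp only [smul_eq_C_mul, smul_eq_mul, map_add, map_sub, map_mul, map_natCast, map_ofNat,
    map_intCast, mul_zero, smul_zero]
  push_cast
  ring

/-- The index set of the vectors `X₊^α D₊^β w_i` with `i ≤ ⌊m/2⌋`. -/
def navIndex (m : ℕ) : Set (ℕ × ℕ × ℕ) := {t | t.2.2 ≤ m / 2}

lemma linearIndependent_of_coord (h : IsVerma (l + m) l ρ w) {ι : Type*} {v : ι → V}
    {f : ι → ℕ × ℕ × ℕ} (hf : Function.Injective f)
    (hv : ∀ t, ∃ c : ℂ, c ≠ 0 ∧ h.coord 0 (v t) = c • fam (f t)) : LinearIndependent ℂ v := by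
  choose c hc e using hv
  refine LinearIndependent.of_comp (h.coord 0) ?_
  convert (linearIndependent_fam.comp f hf).units_smul fun t => Units.mk0 (c t) (hc t) using 1
  funext t
  exact e t

lemma linearIndependent_navVec (h : IsVerma (l + m) l ρ w) :
    LinearIndependent ℂ fun t : navIndex m => navVec ρ w m t := by
  refine h.linearIndependent_of_coord (f := fun t => (t.1.1, t.1.2.1, 2 * t.1.2.2)) ?_ ?_
  · rintro ⟨⟨a, b, i⟩, _⟩ ⟨⟨a', b', i'⟩, _⟩ e
    simp only [Prod.mk.injEq] at e
    obtain ⟨rfl, rfl, e⟩ := e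
    obtain rfl : i = i' := by omega
    rfl
  · rintro ⟨⟨a, b, i⟩, hi⟩
    obtain ⟨c, hc, e⟩ := h.exists_coord_navVec hi
    exact ⟨c, hc, (e a b).1⟩

lemma linearIndependent_opEpGlobal_navVec (h : IsVerma (l + m) l ρ w) :
    LinearIndependent ℂ (opEpGlobal ρ ∘
      fun t : {t : ℕ × ℕ × ℕ | 2 * t.2.2 < m} => navVec ρ w m t) := by
  refine h.linearIndependent_of_coord (f := fun t => (t.1.1, t.1.2.1, 2 * t.1.2.2 + 1)) ?_ ?_
  · rintro ⟨⟨a, b, i⟩, _⟩ ⟨⟨a', b', i'⟩, _⟩ e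
    simp only [Prod.mk.injEq] at e
    obtain ⟨rfl, rfl, e⟩ := e
    obtain rfl : i = i' := by omega
    rfl
  · rintro ⟨⟨a, b, i⟩, hi⟩
    have hi : 2 * i < m := hi
    obtain ⟨c, hc, e⟩ := h.exists_coord_navVec (i := i) (by omega)
    refine ⟨_, mul_ne_zero (sub_ne_zero.2 ?_) hc, (e a b).2⟩
    exact_mod_cast hi.ne'

lemma opEpGlobal_navVec_eq_zero (h : IsVerma (l + m) l ρ w) {t : ℕ × ℕ × ℕ}
    (ht : 2 * t.2.2 = m) : opEpGlobal ρ (navVec ρ w m t) = 0 := by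
  obtain ⟨a, b, i⟩ := t
  obtain ⟨c, -, e⟩ := h.exists_coord_navVec (i := i) (by simp at ht; omega)
  refine h.eq_zero_of_coord_zero ((h.isHWVec_navVec _).opEpGlobal h.rep).annNPlus ?_
  have : (m : ℂ) = 2 * i := by exact_mod_cast ht.symm
  rw [(e a b).2, this, sub_self, zero_mul, zero_smul]

/-- The span of the vectors `X₊^α D₊^β w_i`. -/
def navSpan (ρ : M4C →ₗ[ℂ] Module.End ℂ V) (w : V) (m : ℕ) : Submodule ℂ V :=
  Submodule.span ℂ (navVec ρ w m '' navIndex m)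

lemma navSpan_le (h : IsVerma (l + m) l ρ w) : navSpan ρ w m ≤ parSpace ρ (l + m) 0 := by
  refine Submodule.span_le.2 ?_
  rintro _ ⟨t, -, rfl⟩
  refine IsHWVec.mem_parSpace (x := l + m + 2 * t.2.1 + 2 * t.1) (y := l + 2 * t.2.2 + 2 * t.2.1)
    ?_ (by omega)
  exact_mod_cast h.isHWVec_navVec t

lemma map_navSpan_le (h : IsVerma (l + m) l ρ w) :
    (navSpan ρ w m).map (opEpGlobal ρ) ≤ parSpace ρ (l + m) 1 := by
  rw [navSpan, Submodule.map_span, Submodule.span_le]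
  rintro _ ⟨_, ⟨t, -, rfl⟩, rfl⟩
  refine IsHWVec.mem_parSpace (x := l + m + 2 * t.2.1 + 2 * t.1 + 1)
    (y := l + 2 * t.2.2 + 2 * t.2.1 + 1) ?_ (by omega)
  exact_mod_cast (h.isHWVec_navVec t).opEpGlobal h.rep

lemma ker_NPlus_le (h : IsVerma (l + m) l ρ w) :
    LinearMap.ker (ρ NPlus) ≤ navSpan ρ w m ⊔ (navSpan ρ w m).map (opEpGlobal ρ) := by
  intro v hv
  have hle : navSpan ρ w m ⊔ (navSpan ρ w m).map (opEpGlobal ρ) ≤ LinearMap.ker (ρ NPlus) :=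
    sup_le (h.navSpan_le.trans (parSpace_le_ker ..)) (h.map_navSpan_le.trans (parSpace_le_ker ..))
  have hmem : ∀ {a b i : ℕ}, i ≤ m / 2 → navVec ρ w m (a, b, i) ∈ navSpan ρ w m :=
    fun hi => Submodule.subset_span ⟨_, hi, rfl⟩
  have hfam : Submodule.span ℂ (fam '' {t | t.2.2 < m + 1}) ≤
      (navSpan ρ w m ⊔ (navSpan ρ w m).map (opEpGlobal ρ)).map (h.coord 0) := by
    refine Submodule.span_le.2 ?_
    rintro _ ⟨⟨a, b, n⟩, hn, rfl⟩
    have hn : n < m + 1 := hn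
    obtain ⟨i, rfl | rfl⟩ := n.even_or_odd'
    · have hi : i ≤ m / 2 := by omega
      obtain ⟨c, hc, e⟩ := h.exists_coord_navVec hi
      refine (Submodule.smul_mem_iff _ hc).1 ?_
      rw [← (e a b).1]
      exact Submodule.mem_map_of_mem (Submodule.mem_sup_left (hmem hi))
    · have hi : i ≤ m / 2 := by omega
      obtain ⟨c, hc, e⟩ := h.exists_coord_navVec hi
      have hmi : (m - 2 * i : ℂ) ≠ 0 :=
        sub_ne_zero.2 (by exact_mod_cast (show m ≠ 2 * i by omega))
      refine (Submodule.smul_mem_iff _ (mul_ne_zero hmi hc)).1 ?_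
      rw [← (e a b).2]
      exact Submodule.mem_map_of_mem
        (Submodule.mem_sup_right (Submodule.mem_map_of_mem (hmem hi)))
  obtain ⟨u, hu, e⟩ := hfam (mem_span_fam_of_raise_pow
    (h.raise_pow_coord_zero hv (n := m + 1) (by push_cast; omega)))
  have hvu : v - u = 0 := h.eq_zero_of_coord_zero
    (LinearMap.mem_ker.1 (Submodule.sub_mem _ hv (hle hu))) (by rw [map_sub, e, sub_self])
  rwa [sub_eq_zero.1 hvu]

lemma navSpan_eq (h : IsVerma (l + m) l ρ w) : navSpan ρ w m = parSpace ρ (l + m) 0 := by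
  have hd := disjoint_parSpace ρ (l + m) (zero_ne_one (α := ℤ))
  refine le_antisymm h.navSpan_le ?_
  calc parSpace ρ (l + m) 0
      ≤ (navSpan ρ w m ⊔ (navSpan ρ w m).map (opEpGlobal ρ)) ⊓ parSpace ρ (l + m) 0 :=
        le_inf ((parSpace_le_ker ..).trans h.ker_NPlus_le) le_rfl
    _ = navSpan ρ w m := by
        rw [sup_inf_assoc_of_le _ h.navSpan_le,
          (hd.symm.mono_left h.map_navSpan_le).eq_bot, sup_bot_eq]

lemma map_opEpGlobal_parSpace (h : IsVerma (l + m) l ρ w) :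
    (parSpace ρ (l + m) 0).map (opEpGlobal ρ) = parSpace ρ (l + m) 1 := by
  have hd := disjoint_parSpace ρ (l + m) (zero_ne_one (α := ℤ))
  rw [← h.navSpan_eq]
  refine le_antisymm h.map_navSpan_le ?_
  calc parSpace ρ (l + m) 1
      ≤ ((navSpan ρ w m).map (opEpGlobal ρ) ⊔ navSpan ρ w m) ⊓ parSpace ρ (l + m) 1 :=
        le_inf ((parSpace_le_ker ..).trans (h.ker_NPlus_le.trans_eq (sup_comm ..))) le_rfl
    _ = (navSpan ρ w m).map (opEpGlobal ρ) := by
        rw [sup_inf_assoc_of_le _ h.map_navSpan_le,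
          (hd.mono_left h.navSpan_le).eq_bot, sup_bot_eq]

lemma parSpace_inf_ker (h : IsVerma (l + m) l ρ w) :
    parSpace ρ (l + m) 0 ⊓ LinearMap.ker (opEpGlobal ρ) =
      Submodule.span ℂ (navVec ρ w m '' {t | 2 * t.2.2 = m}) := by
  have hker : Submodule.span ℂ (navVec ρ w m '' {t | 2 * t.2.2 = m}) ≤
      LinearMap.ker (opEpGlobal ρ) := by
    refine Submodule.span_le.2 ?_
    rintro _ ⟨t, ht, rfl⟩
    exact h.opEpGlobal_navVec_eq_zero ht
  have hidx : navIndex m = {t | 2 * t.2.2 = m} ∪ {t | 2 * t.2.2 < m} := by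
    ext t; simp only [navIndex, Set.mem_ofPred_eq, Set.mem_union]; omega
  have hdisj := Submodule.range_ker_disjoint h.linearIndependent_opEpGlobal_navVec
  rw [← Function.comp_def, Set.range_comp, Subtype.range_coe] at hdisj
  rw [← h.navSpan_eq, navSpan, hidx, Set.image_union, Submodule.span_union,
    sup_inf_assoc_of_le _ hker, hdisj.eq_bot, sup_bot_eq]

end IsVerma

/-- Navigating the highest weight vectors of `N(λ)`, `λ = (ℓ+m, ℓ)`, `ℓ ≥ 2`, `m ≥ 0`,
with `w_i = U^i w₀`: (1) the vectors `X₊^α D₊^β w_i` (`α, β ≥ 0`, `0 ≤ i ≤ ⌊m/2⌋`) are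
linearly independent and span `N(λ)_{par(0)}`; (2) if `m` is odd, `E₊` maps `N(λ)_{par(0)}`
bijectively onto `N(λ)_{par(1)}`; (3) if `m` is even, `E₊` maps `N(λ)_{par(0)}` onto
`N(λ)_{par(1)}` with kernel spanned by the vectors `X₊^α D₊^β w_{m/2}`. -/
theorem statement19 (l : ℤ) (hl : 2 ≤ l) (m : ℕ)
    (V : Type) [AddCommGroup V] [Module ℂ V]
    (ρ : M4C →ₗ[ℂ] Module.End ℂ V) (w : V) (h : IsVerma (l + m) l ρ w) :
    (LinearIndependent ℂ
        (fun t : ℕ × ℕ × Fin (m / 2 + 1) =>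
          (((ρ XPlus) ^ t.1 * (opDp ρ) ^ t.2.1)) (wseq ρ w m (t.2.2 : ℕ))) ∧
      Submodule.span ℂ
          (Set.range (fun t : ℕ × ℕ × Fin (m / 2 + 1) =>
            (((ρ XPlus) ^ t.1 * (opDp ρ) ^ t.2.1)) (wseq ρ w m (t.2.2 : ℕ))))
        = parSpace ρ (l + m) 0) ∧
    (Odd m →
      Set.BijOn (fun v => opEpGlobal ρ v)
        (parSpace ρ (l + m) 0 : Set V) (parSpace ρ (l + m) 1 : Set V)) ∧
    (Even m →
      Set.MapsTo (fun v => opEpGlobal ρ v)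
        (parSpace ρ (l + m) 0 : Set V) (parSpace ρ (l + m) 1 : Set V) ∧
      Set.SurjOn (fun v => opEpGlobal ρ v)
        (parSpace ρ (l + m) 0 : Set V) (parSpace ρ (l + m) 1 : Set V) ∧
      parSpace ρ (l + m) 0 ⊓ LinearMap.ker (opEpGlobal ρ)
        = Submodule.span ℂ
            (Set.range (fun t : ℕ × ℕ =>
              (((ρ XPlus) ^ t.1 * (opDp ρ) ^ t.2)) (wseq ρ w m (m / 2))))) := by
  have hr : navVec ρ w m '' IsVerma.navIndex m = Set.range fun t : ℕ × ℕ × Fin (m / 2 + 1) =>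
      (((ρ XPlus) ^ t.1 * (opDp ρ) ^ t.2.1)) (wseq ρ w m (t.2.2 : ℕ)) := by
    ext v
    constructor
    · rintro ⟨⟨a, b, i⟩, hi, rfl⟩
      exact ⟨(a, b, ⟨i, Nat.lt_succ_of_le hi⟩), rfl⟩
    · rintro ⟨⟨a, b, i⟩, rfl⟩
      exact ⟨(a, b, i), Nat.le_of_lt_succ i.2, rfl⟩
  have hmap : Set.MapsTo (fun v => opEpGlobal ρ v)
      (parSpace ρ (l + m) 0 : Set V) (parSpace ρ (l + m) 1 : Set V) := fun v hv =>
    h.map_opEpGlobal_parSpace.le (Submodule.mem_map_of_mem hv)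
  have hsurj : Set.SurjOn (fun v => opEpGlobal ρ v)
      (parSpace ρ (l + m) 0 : Set V) (parSpace ρ (l + m) 1 : Set V) := fun v hv =>
    h.map_opEpGlobal_parSpace.ge hv
  refine ⟨⟨?_, ?_⟩, fun hm => ⟨hmap, ?_, hsurj⟩, fun hm => ⟨hmap, hsurj, ?_⟩⟩
  · refine h.linearIndependent_navVec.comp
      (fun t : ℕ × ℕ × Fin (m / 2 + 1) => ⟨(t.1, t.2.1, t.2.2), Nat.le_of_lt_succ t.2.2.2⟩) ?_
    rintro ⟨a, b, i⟩ ⟨a', b', i'⟩ e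
    have e := congrArg Subtype.val e
    simp only [Prod.mk.injEq] at e
    exact Prod.ext e.1 (Prod.ext e.2.1 (Fin.ext e.2.2))
  · rw [← hr]
    exact h.navSpan_eq
  · have he : {t : ℕ × ℕ × ℕ | 2 * t.2.2 = m} = ∅ :=
      Set.eq_empty_of_forall_notMem fun t ht =>
        Nat.not_even_iff_odd.2 hm ⟨t.2.2, by rw [← two_mul]; exact ht.symm⟩
    have hbot := h.parSpace_inf_ker
    rw [he, Set.image_empty, Submodule.span_empty, ← disjoint_iff] at hbot
    exact LinearMap.injOn_of_disjoint_ker subset_rfl hbot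
  · rw [h.parSpace_inf_ker]
    congr 1
    ext v
    constructor
    · rintro ⟨⟨a, b, i⟩, hi, rfl⟩
      obtain rfl : 2 * i = m := hi
      exact ⟨(a, b), by simp [navVec]⟩
    · rintro ⟨⟨a, b⟩, rfl⟩
      exact ⟨(a, b, m / 2), Nat.two_mul_div_two_of_even hm, rfl⟩

end
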